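/- arXiv:2203.00243 — 5 statements merged into one kernel-verified Lean document; each statement's English description precedes it below -/
import Mathlib

section
/- For every 1 ≤ j ≤ p and every n ≥ j one has A_{[n,j]} = Σ_{k=0}^{n−j} A_{[k,0]} · A^{(1)}_{[n−k−1,j−1]}. (Equivalently, in terms of generating series, A_j(z) = A_0(z)·A^{(1)}_{j−1}(z).) -/
open Finset

/-- The height of the path `γ` after `k` steps, starting at height `h0`.
A step encoded by `v : Fin (p + 2)` changes the height by `1 - v`:
`v = 0` is an upstep, `v = 1` a level step and `v = j + 1` a downstep of size `j`
(for `1 ≤ j ≤ p`). -/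
def ht {p n : ℕ} (h0 : ℤ) (γ : Fin n → Fin (p + 2)) (k : ℕ) : ℤ :=
  h0 + ∑ i ∈ Finset.range k, (if h : i < n then 1 - ((γ ⟨i, h⟩ : ℕ) : ℤ) else 0)

/-- The weight of the path `γ` started at height `h0`: upsteps have weight `1`,
a level step at height `m` has weight `a 0 m`, and a downstep of size `j` from
height `m` has weight `a j (m - j)`, i.e. `a j` evaluated at the final height. -/
noncomputable def wt (a : ℕ → ℤ → ℂ) {p n : ℕ} (h0 : ℤ) (γ : Fin n → Fin (p + 2)) : ℂ :=
  ∏ i : Fin n,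
    if (γ i : ℕ) = 0 then 1 else a ((γ i : ℕ) - 1) (ht h0 γ ((i : ℕ) + 1))

open Classical in
/-- `𝒟_{[n,j]}`: the paths of length `n` from `(0,0)` to `(n,j)` whose vertices
all have height `≥ 0`. -/
noncomputable def Dset (p n j : ℕ) : Finset (Fin n → Fin (p + 2)) :=
  Finset.univ.filter fun γ => ht 0 γ n = (j : ℤ) ∧ ∀ k ≤ n, 0 ≤ ht 0 γ k

open Classical in
/-- `𝒫_{[n,j]}`: all paths of length `n` from `(0,0)` to `(n,j)`. -/
noncomputable def Pset (p n j : ℕ) : Finset (Fin n → Fin (p + 2)) :=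
  Finset.univ.filter fun γ => ht 0 γ n = (j : ℤ)

open Classical in
/-- `𝒟̂_{[n,j]}`: the paths of length `n` from `(0,-j)` to `(n,0)` whose vertices
all have height `≤ 0`. -/
noncomputable def Bhset (p n j : ℕ) : Finset (Fin n → Fin (p + 2)) :=
  Finset.univ.filter fun γ =>
    ht (-(j : ℤ)) γ n = 0 ∧ ∀ k ≤ n, ht (-(j : ℤ)) γ k ≤ 0

/-- The weight polynomial `A^{(q)}_{[n,j]}` (so `A_{[n,j]} = Apoly a p 0 n j`):
the sum over `γ ∈ 𝒟_{[n,j]}` of the weight of the upward shift `γ + q`. -/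
noncomputable def Apoly (a : ℕ → ℤ → ℂ) (p : ℕ) (q : ℤ) (n j : ℕ) : ℂ :=
  ∑ γ ∈ Dset p n j, wt a q γ

/-- The weight polynomial `W_{[n,j]} = Σ_{γ ∈ 𝒫_{[n,j]}} w(γ)`. -/
noncomputable def Wpoly (a : ℕ → ℤ → ℂ) (p n j : ℕ) : ℂ :=
  ∑ γ ∈ Pset p n j, wt a 0 γ

/-- The weight polynomial `B^{(q)}_{[n,j]}`: the sum over `γ ∈ 𝒟̂_{[n,j]}` of the
weight of the downward shift `γ - q` (a path starting at height `-j - q`). -/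
noncomputable def Bpoly (a : ℕ → ℤ → ℂ) (p : ℕ) (q : ℤ) (n j : ℕ) : ℂ :=
  ∑ γ ∈ Bhset p n j, wt a (-(j : ℤ) - q) γ

theorem ht_snoc_le {p n : ℕ} (h0 : ℤ) (γ : Fin n → Fin (p + 2)) (v : Fin (p + 2)) (k : ℕ)
    (hk : k ≤ n) : ht h0 (Fin.snoc γ v : Fin (n + 1) → Fin (p + 2)) k = ht h0 γ k := by
  unfold ht
  congr 1
  refine Finset.sum_congr rfl fun i hi => ?_
  have hi' : i < n := lt_of_lt_of_le (Finset.mem_range.1 hi) hk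
  have hi2 : i < n + 1 := by omega
  rw [dif_pos hi', dif_pos hi2]
  have : (⟨i, hi2⟩ : Fin (n + 1)) = Fin.castSucc ⟨i, hi'⟩ := rfl
  rw [this, Fin.snoc_castSucc (α := fun _ => Fin (p + 2))]

theorem ht_snoc_last {p n : ℕ} (h0 : ℤ) (γ : Fin n → Fin (p + 2)) (v : Fin (p + 2)) :
    ht h0 (Fin.snoc γ v : Fin (n + 1) → Fin (p + 2)) (n + 1)
      = ht h0 γ n + (1 - ((v : ℕ) : ℤ)) := by
  rw [← ht_snoc_le h0 γ v n le_rfl]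
  unfold ht
  rw [Finset.sum_range_succ, ← add_assoc, dif_pos (Nat.lt_succ_self n)]
  have : (⟨n, Nat.lt_succ_self n⟩ : Fin (n + 1)) = Fin.last n := rfl
  rw [this, Fin.snoc_last (α := fun _ => Fin (p + 2))]

theorem ht_shift {p n : ℕ} (h0 : ℤ) (γ : Fin n → Fin (p + 2)) (k : ℕ) :
    ht h0 γ k = h0 + ht 0 γ k := by
  unfold ht
  ring

theorem wt_snoc (a : ℕ → ℤ → ℂ) {p n : ℕ} (h0 : ℤ) (γ : Fin n → Fin (p + 2)) (v : Fin (p + 2)) :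
    wt a h0 (Fin.snoc γ v : Fin (n + 1) → Fin (p + 2))
      = wt a h0 γ * (if (v : ℕ) = 0 then 1
          else a ((v : ℕ) - 1) (ht h0 γ n + (1 - ((v : ℕ) : ℤ)))) := by
  unfold wt
  rw [Fin.prod_univ_castSucc]
  congr 1
  · refine Finset.prod_congr rfl fun i _ => ?_
    rw [Fin.snoc_castSucc (α := fun _ => Fin (p + 2)), Fin.val_castSucc,
      ht_snoc_le h0 γ v _ (by omega)]
  · rw [Fin.snoc_last (α := fun _ => Fin (p + 2)), Fin.val_last, ht_snoc_last]

theorem mem_snoc {p n j : ℕ} (γ : Fin n → Fin (p + 2)) (v : Fin (p + 2)) :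
    (Fin.snoc γ v : Fin (n + 1) → Fin (p + 2)) ∈ Dset p (n + 1) j ↔
      ht 0 γ n = (j : ℤ) + (v : ℕ) - 1 ∧ ∀ k ≤ n, 0 ≤ ht 0 γ k := by
  unfold Dset
  rw [Finset.mem_filter, ht_snoc_last]
  constructor
  · rintro ⟨-, h1, h2⟩
    refine ⟨by linarith, fun k hk => ?_⟩
    rw [← ht_snoc_le 0 γ v k hk]
    exact h2 k (by omega)
  · rintro ⟨h1, h2⟩
    refine ⟨Finset.mem_univ _, by linarith, fun k hk => ?_⟩
    rcases Nat.lt_or_ge n k with h | h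
    · have : k = n + 1 := by omega
      subst this
      rw [ht_snoc_last]
      have : (0 : ℤ) ≤ j := Int.natCast_nonneg j
      linarith
    · rw [ht_snoc_le 0 γ v k h]
      exact h2 k h

theorem mem_D {p n j : ℕ} (γ : Fin n → Fin (p + 2)) :
    γ ∈ Dset p n j ↔ ht 0 γ n = (j : ℤ) ∧ ∀ k ≤ n, 0 ≤ ht 0 γ k := by
  unfold Dset
  rw [Finset.mem_filter]
  simp

open Classical in
theorem Apoly_ite (a : ℕ → ℤ → ℂ) (p : ℕ) (q : ℤ) (n j : ℕ) :
    Apoly a p q n j = ∑ γ : Fin n → Fin (p + 2), if γ ∈ Dset p n j then wt a q γ else 0 := by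
  unfold Apoly
  rw [← Finset.sum_filter]
  congr 1
  ext; simp

open Classical in
theorem Apoly_succ (a : ℕ → ℤ → ℂ) (p : ℕ) (q : ℤ) (n j : ℕ) :
    Apoly a p q (n + 1) j = (if j = 0 then 0 else Apoly a p q n (j - 1))
      + ∑ i : Fin (p + 1), Apoly a p q n (j + i) * a i (q + j) := by
  rw [Apoly_ite, ← (Fin.snocEquiv (fun _ : Fin (n + 1) => Fin (p + 2))).sum_comp,
    Fintype.sum_prod_type, Fin.sum_univ_succ]
  congr 1
  · split_ifs with hj
    · refine Finset.sum_eq_zero fun γ _ => if_neg ?_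
      intro h
      have h := (mem_snoc γ 0).1 h
      have h2 := h.2 n le_rfl
      have h1 := h.1
      subst hj
      simp at h1
      omega
    · rw [Apoly_ite]
      refine Finset.sum_congr rfl fun γ _ => ?_
      have e : ((Fin.snocEquiv (fun _ : Fin (n + 1) => Fin (p + 2))) (0, γ))
        = (Fin.snoc γ 0 : Fin (n + 1) → Fin (p + 2)) := rfl
      rw [e, wt_snoc]
      refine if_congr ?_ (by simp) rfl
      rw [mem_snoc, mem_D]
      have : ((j - 1 : ℕ) : ℤ) = (j : ℤ) - 1 := by omega
      rw [this]
      simp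
  · refine Finset.sum_congr rfl fun i _ => ?_
    rw [Apoly_ite, Finset.sum_mul]
    refine Finset.sum_congr rfl fun γ _ => ?_
    have e : ((Fin.snocEquiv (fun _ : Fin (n + 1) => Fin (p + 2))) (i.succ, γ))
      = (Fin.snoc γ i.succ : Fin (n + 1) → Fin (p + 2)) := rfl
    rw [e, wt_snoc, ite_mul, zero_mul]
    have hiff : (Fin.snoc γ i.succ : Fin (n + 1) → Fin (p + 2)) ∈ Dset p (n + 1) j ↔
        γ ∈ Dset p n (j + i) := by
      rw [mem_snoc, mem_D]
      have : (j : ℤ) + ((i.succ : Fin (p + 2)) : ℕ) - 1 = ((j + (i : ℕ) : ℕ) : ℤ) := by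
        rw [Fin.val_succ]; push_cast; ring
      rw [this]
    by_cases hm : γ ∈ Dset p n (j + i)
    · rw [if_pos hm, if_pos (hiff.2 hm), if_neg (by simp), ht_shift, ((mem_D γ).1 hm).1]
      congr 2
      rw [Fin.val_succ]; push_cast; ring
    · rw [if_neg hm, if_neg (fun h => hm (hiff.1 h))]

theorem Apoly_zero (a : ℕ → ℤ → ℂ) (p : ℕ) (q : ℤ) (j : ℕ) :
    Apoly a p q 0 j = if j = 0 then 1 else 0 := by
  classical
  rw [Apoly_ite, Fintype.sum_unique]
  refine if_congr ?_ (by simp [wt]) rfl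
  rw [mem_D]
  simp [ht]
  omega

theorem Apoly_lt (a : ℕ → ℤ → ℂ) (p : ℕ) (q : ℤ) (n : ℕ) :
    ∀ j : ℕ, n < j → Apoly a p q n j = 0 := by
  induction n with
  | zero => intro j hj; rw [Apoly_zero, if_neg (by omega)]
  | succ n ih =>
    intro j hj
    rw [Apoly_succ, if_neg (by omega), ih _ (by omega), zero_add]
    refine Finset.sum_eq_zero fun i _ => ?_
    rw [ih _ (by omega), zero_mul]

theorem Apoly_main (a : ℕ → ℤ → ℂ) (p : ℕ) (n : ℕ) :
    ∀ j : ℕ, Apoly a p 0 n (j + 1) =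
      ∑ k ∈ Finset.range n, Apoly a p 0 k 0 * Apoly a p 1 (n - k - 1) j := by
  induction n with
  | zero => intro j; rw [Apoly_lt _ _ _ _ _ (by omega)]; simp
  | succ n ih =>
    intro j
    have hR : ∀ k ∈ Finset.range n, Apoly a p 0 k 0 * Apoly a p 1 (n + 1 - k - 1) j
        = Apoly a p 0 k 0 * (if j = 0 then 0 else Apoly a p 1 (n - k - 1) (j - 1))
        + ∑ i : Fin (p + 1), (Apoly a p 0 k 0 * Apoly a p 1 (n - k - 1) (j + i))
            * a i (1 + j) := by
      intro k hk
      have hk := Finset.mem_range.1 hk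
      have : n + 1 - k - 1 = (n - k - 1) + 1 := by omega
      rw [this, Apoly_succ, mul_add, Finset.mul_sum]
      simp only [mul_assoc]
    rw [Finset.sum_range_succ, Finset.sum_congr rfl hR, Finset.sum_add_distrib,
      Finset.sum_comm, Apoly_succ, if_neg (by omega)]
    have hS : ∀ i : Fin (p + 1), Apoly a p 0 n (j + 1 + i) * a i (0 + ((j + 1 : ℕ) : ℤ))
        = ∑ k ∈ Finset.range n, (Apoly a p 0 k 0 * Apoly a p 1 (n - k - 1) (j + i))
            * a i (1 + j) := by
      intro i
      have h1 : j + 1 + (i : ℕ) = j + i + 1 := by omega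
      have h2 : (0 : ℤ) + ((j + 1 : ℕ) : ℤ) = 1 + j := by push_cast; ring
      rw [h1, h2, ih, Finset.sum_mul]
    rw [Finset.sum_congr rfl (fun i _ => hS i)]
    have h3 : n + 1 - n - 1 = 0 := by omega
    rw [h3, Apoly_zero, Nat.add_sub_cancel]
    rcases j with _ | j
    · simp
      ring
    · rw [ih]
      simp

/-- For every `1 ≤ j ≤ p` and `n ≥ j`,
`A_{[n,j]} = Σ_{k=0}^{n-j} A_{[k,0]} · A^{(1)}_{[n-k-1,j-1]}`. -/
theorem stmt1 (p : ℕ) (hp : 1 ≤ p) (a : ℕ → ℤ → ℂ) (j n : ℕ)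
    (hj1 : 1 ≤ j) (hjp : j ≤ p) (hn : j ≤ n) :
    Apoly a p 0 n j =
      ∑ k ∈ Finset.range (n - j + 1), Apoly a p 0 k 0 * Apoly a p 1 (n - k - 1) (j - 1) := by
  obtain ⟨j, rfl⟩ : ∃ i, j = i + 1 := ⟨j - 1, by omega⟩
  rw [Apoly_main, Nat.add_sub_cancel]
  symm
  refine Finset.sum_subset ?_ ?_
  · intro k hk
    rw [Finset.mem_range] at *
    omega
  · intro k hk hk2
    rw [Finset.mem_range] at *
    rw [Apoly_lt a p 1 _ _ (by omega), mul_zero]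
end

section
/- For every m ≥ 0 and 0 ≤ j ≤ p, R_{[m(p+1)+j, j]} = Σ_{i₁=−p}^{(m−1)p+j} Σ_{i₂=i₁−p}^{(m−2)p+j} Σ_{i₃=i₂−p}^{(m−3)p+j} ⋯ Σ_{i_m=i_{m−1}−p}^{j} Π_{k=1}^{m} a_{i_k}, where the right-hand side is understood to be 1 when m = 0. -/
open Finset

/-- The height of the path `γ` after `k` steps, starting at height `h0`.
A step with `γ i = false` is an upstep (height change `+1`) and a step with
`γ i = true` is a downstep by `p` units (height change `-p`). -/
def htB (p : ℕ) {n : ℕ} (h0 : ℤ) (γ : Fin n → Bool) (k : ℕ) : ℤ :=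
  h0 + ∑ i ∈ Finset.range k,
    (if h : i < n then (if γ ⟨i, h⟩ then -(p : ℤ) else 1) else 0)

/-- The weight of the path `γ` started at height `h0`: upsteps have weight `1` and
a downstep from height `m` has weight `a (m - p)`, i.e. `a` evaluated at its final
height. -/
noncomputable def wtB (a : ℤ → ℂ) (p : ℕ) {n : ℕ} (h0 : ℤ) (γ : Fin n → Bool) : ℂ :=
  ∏ i : Fin n, if γ i then a (htB p h0 γ ((i : ℕ) + 1)) else 1

open Classical in
/-- `ℛ_{[n,j]}`: all paths of length `n` from `(0,0)` to `(n,j)` with upsteps and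
downsteps by `p` (heights may be negative). -/
noncomputable def Rset (p n j : ℕ) : Finset (Fin n → Bool) :=
  Finset.univ.filter fun γ => htB p 0 γ n = (j : ℤ)

open Classical in
/-- `𝒮_{[n,j]}`: the paths in `ℛ_{[n,j]}` whose vertices all have height `≥ 0`
(partial `p`-Dyck paths). -/
noncomputable def Sset (p n j : ℕ) : Finset (Fin n → Bool) :=
  Finset.univ.filter fun γ => htB p 0 γ n = (j : ℤ) ∧ ∀ k ≤ n, 0 ≤ htB p 0 γ k

open Classical in
/-- `Ŝ_{[n,j]}`: the paths of length `n` from `(0,-j)` to `(n,0)` whose vertices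
all have height `≤ 0`. -/
noncomputable def Shatset (p n j : ℕ) : Finset (Fin n → Bool) :=
  Finset.univ.filter fun γ =>
    htB p (-(j : ℤ)) γ n = 0 ∧ ∀ k ≤ n, htB p (-(j : ℤ)) γ k ≤ 0

/-- The weight polynomial `R_{[n,j]} = Σ_{γ ∈ ℛ_{[n,j]}} w(γ)`. -/
noncomputable def Rpoly (a : ℤ → ℂ) (p n j : ℕ) : ℂ :=
  ∑ γ ∈ Rset p n j, wtB a p 0 γ

/-- The weight polynomial `S^{(q)}_{[n,j]}` (so `S_{[n,j]} = Spoly a p 0 n j`):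
the sum over `γ ∈ 𝒮_{[n,j]}` of the weight of the upward shift `γ + q`. -/
noncomputable def Spoly (a : ℤ → ℂ) (p : ℕ) (q : ℤ) (n j : ℕ) : ℂ :=
  ∑ γ ∈ Sset p n j, wtB a p q γ

/-- The weight polynomial `T_{[n,j]} = Σ_{γ ∈ Ŝ_{[n,j]}} w(γ)`. -/
noncomputable def Tpoly (a : ℤ → ℂ) (p n j : ℕ) : ℂ :=
  ∑ γ ∈ Shatset p n j, wtB a p (-(j : ℤ)) γ

lemma htB_cons (p n : ℕ) (h : ℤ) (b : Bool) (γ : Fin n → Bool) (k : ℕ) :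
    htB p h (Fin.cons b γ : Fin (n+1) → Bool) (k+1)
      = htB p (h + if b then -(p:ℤ) else 1) γ k := by
  unfold htB
  rw [Finset.sum_range_succ']
  have h0 : ∀ i ∈ Finset.range k,
      (if hh : i + 1 < n + 1 then
        (if (Fin.cons b γ : Fin (n+1) → Bool) ⟨i+1, hh⟩ then -(p : ℤ) else 1) else 0)
      = (if hh : i < n then (if γ ⟨i, hh⟩ then -(p : ℤ) else 1) else 0) := by
    intro i _
    by_cases hi : i < n
    · rw [dif_pos hi, dif_pos (Nat.succ_lt_succ hi)]
      rfl
    · rw [dif_neg hi, dif_neg (by omega)]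
  rw [Finset.sum_congr rfl h0, dif_pos (Nat.succ_pos n)]
  have : (Fin.cons b γ : Fin (n+1) → Bool) ⟨0, Nat.succ_pos n⟩ = b := rfl
  rw [this]
  ring

lemma wtB_cons (a : ℤ → ℂ) (p n : ℕ) (h : ℤ) (b : Bool) (γ : Fin n → Bool) :
    wtB a p h (Fin.cons b γ : Fin (n+1) → Bool)
      = (if b then a (h - p) else 1) * wtB a p (h + if b then -(p:ℤ) else 1) γ := by
  unfold wtB
  rw [Fin.prod_univ_succ]
  congr 1
  · have : htB p h (Fin.cons b γ : Fin (n+1) → Bool) (((0 : Fin (n+1)) : ℕ) + 1)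
      = (h + if b then -(p:ℤ) else 1) := by
      have := htB_cons p n h b γ 0
      simpa [htB] using this
    rw [this]
    cases b <;> simp [sub_eq_add_neg]
  · refine Finset.prod_congr rfl fun i _ => ?_
    rw [Fin.val_succ, htB_cons, Fin.cons_succ]

noncomputable def WW (a : ℤ → ℂ) (p n : ℕ) (h j : ℤ) : ℂ :=
  ∑ γ : Fin n → Bool, if htB p h γ n = j then wtB a p h γ else 0

lemma WW_zero (a : ℤ → ℂ) (p : ℕ) (h j : ℤ) : WW a p 0 h j = if h = j then 1 else 0 := by
  simp [WW, htB, wtB]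

lemma WW_succ (a : ℤ → ℂ) (p n : ℕ) (h j : ℤ) :
    WW a p (n+1) h j = WW a p n (h+1) j + a (h - p) * WW a p n (h - p) j := by
  unfold WW
  rw [← (Fin.consEquiv (fun _ : Fin (n+1) => Bool)).sum_comp, Fintype.sum_prod_type]
  change ∑ b : Bool, ∑ γ : Fin n → Bool,
    (if htB p h (Fin.cons b γ : Fin (n+1) → Bool) (n+1) = j
      then wtB a p h (Fin.cons b γ : Fin (n+1) → Bool) else 0) = _
  simp only [htB_cons, wtB_cons]
  rw [Fintype.sum_bool, add_comm, Finset.mul_sum]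
  simp [sub_eq_add_neg]

lemma WW_vanish (a : ℤ → ℂ) (p n : ℕ) : ∀ (h j : ℤ), (n:ℤ) < j - h → WW a p n h j = 0 := by
  induction n with
  | zero => intro h j hh; rw [WW_zero, if_neg]; push_cast at hh; omega
  | succ n ih =>
    intro h j hh
    push_cast at hh
    rw [WW_succ, ih _ _ (by omega), ih _ _ (by omega)]
    simp

noncomputable def NN (a : ℤ → ℂ) (p : ℕ) (j : ℤ) : ℕ → ℤ → ℂ
  | 0, _ => 1
  | m+1, h => ∑ x ∈ Finset.Icc (h - p) (m * p + j), a x * NN a p j m x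

lemma NN_vanish (a : ℤ → ℂ) (p : ℕ) (j : ℤ) (m : ℕ) (h : ℤ) (hh : m * p + j < h - p) :
    NN a p j (m+1) h = 0 := by
  rw [NN, Finset.Icc_eq_empty (by omega)]
  simp

lemma WW_eq_NN (a : ℤ → ℂ) (p : ℕ) (j : ℤ) (n : ℕ) : ∀ (m : ℕ) (h : ℤ),
    j - h = n - m * (p + 1) → WW a p n h j = NN a p j m h := by
  induction n with
  | zero =>
    intro m h hh
    rw [WW_zero]
    cases m with
    | zero => rw [if_pos (by push_cast at hh; linarith)]; rfl
    | succ m =>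
      push_cast at hh
      have : (0:ℤ) ≤ m * p := by positivity
      rw [if_neg (by intro h'; nlinarith), NN_vanish _ _ _ _ _ (by nlinarith)]
  | succ n ih =>
    intro m h hh
    rw [WW_succ]
    push_cast at hh
    rw [ih m (h+1) (by linarith)]
    cases m with
    | zero =>
      rw [WW_vanish _ _ _ _ _ (by push_cast at hh; linarith)]
      simp [NN]
    | succ m =>
      push_cast at hh
      rw [ih m (h - p) (by linarith)]
      by_cases hc : h - p ≤ m * p + j
      · rw [NN, NN, ← Finset.insert_Icc_add_one_left_eq_Icc hc, Finset.sum_insert (by simp), add_comm]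
        congr 3
        ring
      · rw [NN_vanish a p j m h (by linarith), NN_vanish a p j m (h+1) (by linarith)]
        cases m with
        | zero => exfalso; apply hc; push_cast at *; linarith
        | succ m =>
          rw [NN_vanish a p j m (h - p) (by push_cast at *; linarith)]
          simp

noncomputable def FF (p : ℕ) (j : ℤ) : (m : ℕ) → ℤ → Finset (Fin m → ℤ)
  | 0, _ => {Fin.elim0}
  | m+1, h => ((Finset.Icc (h - p) (m * p + j)).sigma (fun x => FF p j m x)).map
      ⟨fun s => (Fin.cons s.1 s.2 : Fin (m+1) → ℤ), by
        rintro ⟨x, y⟩ ⟨x', y'⟩ hxy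
        obtain ⟨h1, h2⟩ := Fin.cons_inj.1 hxy
        subst h1; subst h2; rfl⟩

lemma sum_FF (a : ℤ → ℂ) (p : ℕ) (j : ℤ) (m : ℕ) : ∀ h : ℤ,
    ∑ i ∈ FF p j m h, ∏ k, a (i k) = NN a p j m h := by
  induction m with
  | zero => intro h; simp [FF, NN]
  | succ m ih =>
    intro h
    rw [FF, NN, Finset.sum_map, Finset.sum_sigma]
    refine Finset.sum_congr rfl fun x _ => ?_
    rw [← ih, Finset.mul_sum]
    refine Finset.sum_congr rfl fun i _ => ?_
    rw [Fin.prod_univ_succ]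
    rfl

lemma cons_mem_FF (p : ℕ) (j : ℤ) (m : ℕ) (h x : ℤ) (i : Fin m → ℤ) :
    (Fin.cons x i : Fin (m+1) → ℤ) ∈ FF p j (m+1) h ↔
      (h - p ≤ x ∧ x ≤ m * p + j) ∧ i ∈ FF p j m x := by
  rw [FF, Finset.mem_map]
  constructor
  · rintro ⟨⟨x', i'⟩, h1, h2⟩
    obtain ⟨h3, h4⟩ := Fin.cons_inj.1 (show (Fin.cons x' i' : Fin (m+1) → ℤ) = Fin.cons x i from h2)
    subst h3; subst h4
    simpa using h1
  · intro h1
    exact ⟨⟨x, i⟩, by simpa using h1, rfl⟩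

lemma mem_FF (p : ℕ) (j : ℤ) (m : ℕ) : ∀ (h : ℤ) (i : Fin m → ℤ), i ∈ FF p j m h ↔
    ∀ k : Fin m,
          ((k : ℕ) = 0 → h - (p : ℤ) ≤ i k) ∧
          i k ≤ ((m : ℤ) - 1 - (k : ℕ)) * p + j ∧
          ∀ k' : Fin m, (k' : ℕ) = (k : ℕ) + 1 → i k - p ≤ i k' := by
  induction m with
  | zero => intro h i; simp [FF]; exact Subsingleton.elim _ _
  | succ m ih =>
    intro h i
    induction i using Fin.consCases with
    | _ x i =>
    rw [cons_mem_FF, ih]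
    simp only [Fin.forall_fin_succ (n := m), Fin.cons_zero, Fin.cons_succ, Fin.val_succ,
      Fin.val_zero]
    have e : ∀ k : ℕ, ((m+1 : ℕ) : ℤ) - 1 - ((k + 1 : ℕ) : ℤ) = (m:ℤ) - 1 - k := by
      intro k; push_cast; ring
    have e0 : ((m+1 : ℕ) : ℤ) - 1 - ((0 : ℕ) : ℤ) = (m:ℤ) := by push_cast; ring
    simp only [e, e0]
    constructor
    · rintro ⟨⟨h1, h2⟩, h3⟩
      refine ⟨⟨fun _ => h1, h2, by omega, fun k hk => (h3 k).1 (by omega)⟩, fun k =>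
        ⟨by omega, (h3 k).2.1, by omega, fun k' hk => (h3 k).2.2 k' (by omega)⟩⟩
    · rintro ⟨⟨h1, h2, _, h4⟩, h3⟩
      exact ⟨⟨h1 trivial, h2⟩, fun k => ⟨fun hk => h4 k (by omega), (h3 k).2.1,
        fun k' hk => (h3 k).2.2.2 k' (by omega)⟩⟩

/-- For every `m ≥ 0` and `0 ≤ j ≤ p`,
`R_{[m(p+1)+j,j]} = Σ_{i₁=-p}^{(m-1)p+j} Σ_{i₂=i₁-p}^{(m-2)p+j} ⋯ Σ_{i_m=i_{m-1}-p}^{j} Π_{k=1}^{m} a_{i_k}`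
(the empty sum of products being `1` when `m = 0`); the nested sum is expressed as a
sum over the tuples `(i_0, …, i_{m-1})` satisfying the corresponding inequalities. -/
theorem stmt6 (p : ℕ) (hp : 1 ≤ p) (a : ℤ → ℂ) (m j : ℕ) (hj : j ≤ p) :
    Rpoly a p (m * (p + 1) + j) j =
      ∑ᶠ i ∈ {i : Fin m → ℤ |
        ∀ k : Fin m,
          ((k : ℕ) = 0 → -(p : ℤ) ≤ i k) ∧
          i k ≤ ((m : ℤ) - 1 - (k : ℕ)) * p + j ∧
          ∀ k' : Fin m, (k' : ℕ) = (k : ℕ) + 1 → i k - p ≤ i k'},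
        ∏ k, a (i k) := by
  have h1 : Rpoly a p (m * (p + 1) + j) j = WW a p (m * (p + 1) + j) 0 j := by
    unfold Rpoly Rset WW
    rw [Finset.sum_filter]
  rw [h1, WW_eq_NN a p j _ m 0 (by push_cast; ring), ← sum_FF, ← finsum_mem_coe_finset]
  refine finsum_mem_congr ?_ (fun _ _ => rfl)
  ext i
  have := mem_FF p j m 0 i
  rw [zero_sub] at this
  exact this
end

section
/- For every m ≥ 0 and 0 ≤ j ≤ p, the number of paths in 𝒮_{[m(p+1)+j, j]} equals the Fuss–Catalan number ((j+1)/(pm+j+1))·C(m(p+1)+j, m); equivalently, (pm+j+1)·card(𝒮_{[m(p+1)+j, j]}) = (j+1)·C(m(p+1)+j, m). -/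
open Finset

theorem htB_snoc_le (p n : ℕ) (γ : Fin n → Bool) (b : Bool) (k : ℕ) (hk : k ≤ n) :
    htB p 0 (Fin.snoc (α := fun _ => Bool) γ b) k = htB p 0 γ k := by
  unfold htB
  congr 1
  apply Finset.sum_congr rfl
  intro i hi
  have hi' : i < n := lt_of_lt_of_le (Finset.mem_range.mp hi) hk
  rw [dif_pos hi', dif_pos (Nat.lt_succ_of_lt hi')]
  have : (⟨i, Nat.lt_succ_of_lt hi'⟩ : Fin (n+1)) = Fin.castSucc ⟨i, hi'⟩ := rfl
  rw [this, Fin.snoc_castSucc]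

theorem htB_snoc_last (p n : ℕ) (γ : Fin n → Bool) (b : Bool) :
    htB p 0 (Fin.snoc (α := fun _ => Bool) γ b) (n+1)
      = htB p 0 γ n + (if b then -(p:ℤ) else 1) := by
  rw [← htB_snoc_le p n γ b n le_rfl]
  unfold htB
  rw [Finset.sum_range_succ, dif_pos (Nat.lt_succ_self n)]
  have : (⟨n, Nat.lt_succ_self n⟩ : Fin (n+1)) = Fin.last n := rfl
  rw [this, Fin.snoc_last, add_assoc]

open Classical in
theorem card_split (p n j : ℕ) : (Sset p (n+1) j).card = (Sset p n (j+p)).card +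
    (Finset.univ.filter fun γ : Fin n → Bool =>
      htB p 0 γ n + 1 = (j : ℤ) ∧ ∀ k ≤ n, 0 ≤ htB p 0 γ k).card := by
  unfold Sset
  simp only [Finset.card_filter]
  rw [← (Fin.snocEquiv (fun _ : Fin (n+1) => Bool)).sum_comp, Fintype.sum_prod_type,
    Fintype.sum_bool]
  congr 1
  all_goals
    apply Finset.sum_congr rfl
    intro γ _
    congr 1
    simp only [Fin.snocEquiv, Equiv.coe_fn_mk, eq_iff_iff]
    rw [htB_snoc_last]
    constructor
    · rintro ⟨h1, h2⟩
      refine ⟨by push_cast; simp at h1; linarith, fun k hk => ?_⟩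
      have := h2 k (by omega)
      rwa [htB_snoc_le _ _ _ _ _ hk] at this
    · rintro ⟨h1, h2⟩
      refine ⟨by push_cast at h1; simp; linarith, fun k hk => ?_⟩
      rcases Nat.lt_or_ge n k with h | h
      · obtain rfl : k = n + 1 := by omega
        rw [htB_snoc_last]
        have := h2 n le_rfl
        push_cast at h1
        simp
        linarith
      · rw [htB_snoc_le _ _ _ _ _ h]; exact h2 k h

theorem card_succ_succ (p n j : ℕ) :
    (Sset p (n+1) (j+1)).card = (Sset p n (j+1+p)).card + (Sset p n j).card := by
  rw [card_split]
  congr 2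
  unfold Sset
  ext γ
  simp

theorem card_succ_zero (p n : ℕ) :
    (Sset p (n+1) 0).card = (Sset p n p).card := by
  rw [card_split, Nat.zero_add, Nat.add_eq_left, Finset.card_eq_zero,
    Finset.filter_eq_empty_iff]
  rintro γ _ ⟨h1, h2⟩
  have := h2 n le_rfl
  push_cast at h1
  linarith

theorem card_zero (p j : ℕ) : (Sset p 0 j).card = if j = 0 then 1 else 0 := by
  unfold Sset
  simp only [Finset.card_filter]
  simp [htB, eq_comm]

theorem key (p n : ℕ) : ∀ j, (n < j → (Sset p n j).card = 0) ∧
    ∀ m, n = m * (p+1) + j → (p * m + j + 1) * (Sset p n j).card = (j + 1) * Nat.choose n m := by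
  induction n with
  | zero =>
    intro j
    rw [card_zero]
    refine ⟨fun h => by simp; omega, fun m hm => ?_⟩
    obtain rfl : j = 0 := by omega
    obtain rfl : m = 0 := by
      rcases m with _ | m
      · rfl
      · rw [Nat.succ_mul] at hm; omega
    simp
  | succ n ih =>
    intro j
    rcases j with _ | j
    · refine ⟨fun h => by omega, fun m hm => ?_⟩
      rw [card_succ_zero]
      rcases m with _ | m
      · omega
      · have hn : n = m * (p+1) + p := by rw [Nat.succ_mul] at hm; omega
        have h := (ih p).2 m hn
        have hc := Nat.choose_succ_right_eq n m
        have hs : n - m = p * (m + 1) := by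
          have : n = p * (m+1) + m := by rw [hn]; ring
          omega
        rw [hs] at hc
        have hc' : n.choose (m+1) = n.choose m * p :=
          Nat.eq_of_mul_eq_mul_right (Nat.succ_pos m) (by rw [Nat.succ_eq_add_one, hc]; ring)
        rw [Nat.choose_succ_succ, hc']
        linarith
    · rw [card_succ_succ]
      refine ⟨fun h => ?_, fun m hm => ?_⟩
      · rw [(ih _).1 (by omega), (ih _).1 (by omega)]
      · have hA := (ih j).2 m (by omega)
        rcases m with _ | m
        · rw [(ih _).1 (by omega)]
          simp at hA ⊢
          rw [hA]
        · have hn : n = m * (p+1) + (j + 1 + p) := by rw [Nat.succ_mul] at hm; omega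
          have hB := (ih _).2 m hn
          have hc := Nat.choose_succ_right_eq n m
          have hs : n - m = p * (m + 1) + j + 1 := by
            have : n = p * (m+1) + j + 1 + m := by rw [hn]; ring
            omega
          rw [hs] at hc
          rw [Nat.choose_succ_succ, Nat.succ_eq_add_one]
          generalize (Sset p n (j+1+p)).card = B at *
          generalize (Sset p n j).card = A at *
          generalize n.choose (m+1) = c at *
          generalize n.choose m = d at *
          apply Nat.eq_of_mul_eq_mul_left (Nat.succ_pos (p * (m+1) + j))
          rw [Nat.succ_eq_add_one]
          zify at *
          linear_combination ((p:ℤ) * (m+1) + j + 2) * hA + ((p:ℤ) * (m+1) + j + 1) * hB - (p:ℤ) * hc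

/-- For every `m ≥ 0` and `0 ≤ j ≤ p`, the number of partial `p`-Dyck paths in
`𝒮_{[m(p+1)+j,j]}` is the Fuss–Catalan number `((j+1)/(pm+j+1))·C(m(p+1)+j, m)`;
equivalently `(pm+j+1)·card 𝒮_{[m(p+1)+j,j]} = (j+1)·C(m(p+1)+j, m)`. -/
theorem stmt10 (p : ℕ) (hp : 1 ≤ p) (m j : ℕ) (hj : j ≤ p) :
    (p * m + j + 1) * (Sset p (m * (p + 1) + j) j).card =
      (j + 1) * Nat.choose (m * (p + 1) + j) m := by
  exact (key p _ j).2 m rfl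
end

section
/- For every m ≥ 0 and 0 ≤ j ≤ p and every sequence a : ℤ → ℂ, one has T_{[m(p+1)+j, j]}(a) = S_{[m(p+1)+j, j]}(â), where â is the sequence defined by â_k = a_{−p−k} for all k ∈ ℤ; that is, T_{[n,j]} is obtained from S_{[n,j]} by substituting the variable a_k by a_{−p−k}. (This follows from the bijection γ ↦ γ̂ from 𝒮_{[n,j]} to Ŝ_{[n,j]} given by reflecting γ in the x-axis and then in the vertical line x = n/2.) -/
open Finset

theorem aux_succ (p : ℕ) {n : ℕ} (h0 : ℤ) (γ : Fin n → Bool) (k : ℕ) (hk : k < n) :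
    htB p h0 γ (k + 1) = htB p h0 γ k + (if γ ⟨k, hk⟩ then -(p : ℤ) else 1) := by
  unfold htB
  rw [Finset.sum_range_succ, dif_pos hk, add_assoc]

theorem aux_rev (p : ℕ) {n : ℕ} (h : ℤ) (γ : Fin n → Bool) (k : ℕ) (hk : k ≤ n) :
    htB p h (fun i => γ i.rev) k = h + htB p 0 γ n - htB p 0 γ (n - k) := by
  induction k with
  | zero => simp [htB]
  | succ k ih =>
    have e : n - k = (n - (k + 1)) + 1 := by omega
    have h1 := aux_succ p 0 γ (n - (k + 1)) (by omega)
    have h2 := ih (by omega)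
    rw [e, h1] at h2
    rw [aux_succ p h _ k (by omega), h2]
    have e2 : (Fin.rev ⟨k, by omega⟩ : Fin n) = ⟨n - (k + 1), by omega⟩ := by
      ext; simp [Fin.rev]
    rw [e2]
    ring

theorem aux_wt (a : ℤ → ℂ) (p : ℕ) {n : ℕ} (j : ℕ) (γ : Fin n → Bool)
    (hγ : htB p 0 γ n = (j : ℤ)) :
    wtB a p (-(j : ℤ)) (fun i => γ i.rev) = wtB (fun k => a (-(p : ℤ) - k)) p 0 γ := by
  unfold wtB
  rw [← Equiv.prod_comp Fin.revPerm]
  refine Finset.prod_congr rfl fun i _ => ?_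
  simp only [Fin.revPerm_apply, Fin.rev_rev]
  split_ifs with hi
  · rw [aux_rev p _ γ _ (by omega), hγ, aux_succ p 0 γ i i.2]
    have e : n - ((i.rev : ℕ) + 1) = i := by
      have := i.2
      simp only [Fin.val_rev]; omega
    rw [e]
    simp [hi]
  · rfl

theorem aux_mem (p n j : ℕ) (γ : Fin n → Bool) :
    γ ∈ Sset p n j ↔ (fun i => γ i.rev) ∈ Shatset p n j := by
  have h0 : htB p 0 γ 0 = 0 := by simp [htB]
  simp only [Sset, Shatset, Finset.mem_filter, Finset.mem_univ, true_and]
  have hn := aux_rev p (-(j : ℤ)) γ n le_rfl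
  rw [Nat.sub_self, h0] at hn
  constructor
  · rintro ⟨h1, h2⟩
    refine ⟨by omega, fun k hk => ?_⟩
    rw [aux_rev p _ γ k hk]
    have := h2 (n - k) (by omega)
    omega
  · rintro ⟨h1, h2⟩
    refine ⟨by omega, fun k hk => ?_⟩
    have h3 := h2 (n - k) (by omega)
    rw [aux_rev p _ γ _ (by omega), Nat.sub_sub_self hk] at h3
    omega

/-- For every `m ≥ 0`, `0 ≤ j ≤ p` and every weight sequence `a : ℤ → ℂ`,
`T_{[m(p+1)+j,j]}(a) = S_{[m(p+1)+j,j]}(â)` where `â_k = a_{-p-k}`. -/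
theorem stmt11 (p : ℕ) (hp : 1 ≤ p) (m j : ℕ) (hj : j ≤ p) (a : ℤ → ℂ) :
    Tpoly a p (m * (p + 1) + j) j =
      Spoly (fun k => a (-(p : ℤ) - k)) p 0 (m * (p + 1) + j) j := by
  unfold Tpoly Spoly
  symm
  refine Finset.sum_bij' (fun γ _ => fun i => γ i.rev) (fun γ _ => fun i => γ i.rev)
    ?_ ?_ ?_ ?_ ?_
  · intro γ h
    exact (aux_mem _ _ _ γ).1 h
  · intro γ h
    rw [aux_mem]
    simpa using h
  · intro γ _
    simp
  · intro γ _
    simp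
  · intro γ h
    simp only [Sset, Finset.mem_filter] at h
    exact (aux_wt a p j γ h.2.1).symm
end

section
/- Fix an integer q ≥ 0 and let ℬ_q be the linear endomorphism of the space ℕ →₀ ℂ of finitely supported sequences determined on the standard basis (e_n)_{n≥0} by ℬ_q e_0 = Σ_{k=0}^{p} a^{(k)}_{−k−q} e_k and ℬ_q e_n = e_{n−1} + Σ_{k=0}^{p} a^{(k)}_{−k−q−n} e_{n+k} for n ≥ 1. Then for every n ≥ 0 and every 0 ≤ j ≤ p, the coefficient of e_0 in ℬ_q^n e_j equals the weight polynomial B^{(q)}_{[n,j]}; that is, ⟨ℬ_q^n e_j, e_0⟩ = B^{(q)}_{[n,j]}. -/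
open Finset

lemma ht_zero' {p n : ℕ} (h0 : ℤ) (γ : Fin n → Fin (p + 2)) : ht h0 γ 0 = h0 := by
  simp [ht]

lemma ht_cons {p n : ℕ} (h0 : ℤ) (v : Fin (p + 2)) (γ : Fin n → Fin (p + 2)) (k : ℕ) :
    ht h0 (Fin.cons v γ : Fin (n + 1) → Fin (p + 2)) (k + 1) = ht (h0 + 1 - ((v : ℕ) : ℤ)) γ k := by
  unfold ht
  rw [Finset.sum_range_succ']
  have h : ∀ i : ℕ, (if h : i + 1 < n + 1 then
      1 - (((Fin.cons v γ : Fin (n + 1) → Fin (p + 2)) ⟨i + 1, h⟩ : ℕ) : ℤ) else 0) =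
      (if h : i < n then 1 - ((γ ⟨i, h⟩ : ℕ) : ℤ) else 0) := by
    intro i
    by_cases hi : i < n
    · rw [dif_pos hi, dif_pos (by omega)]
      rfl
    · rw [dif_neg hi, dif_neg (by omega)]
  rw [Finset.sum_congr rfl (fun i _ => h i), dif_pos (Nat.succ_pos n)]
  have : (Fin.cons v γ : Fin (n + 1) → Fin (p + 2)) ⟨0, Nat.succ_pos n⟩ = v := rfl
  rw [this]
  ring

lemma wt_cons (a : ℕ → ℤ → ℂ) {p n : ℕ} (h0 : ℤ) (v : Fin (p + 2)) (γ : Fin n → Fin (p + 2)) :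
    wt a h0 (Fin.cons v γ : Fin (n + 1) → Fin (p + 2)) =
      (if (v : ℕ) = 0 then 1 else a ((v : ℕ) - 1) (h0 + 1 - ((v : ℕ) : ℤ))) *
        wt a (h0 + 1 - ((v : ℕ) : ℤ)) γ := by
  unfold wt
  rw [Fin.prod_univ_succ]
  simp only [Fin.cons_zero, Fin.cons_succ, Fin.val_succ, ht_cons, Fin.val_zero, ht_zero']

open Classical in
noncomputable def Gpoly (a : ℕ → ℤ → ℂ) (p : ℕ) (q : ℤ) (n : ℕ) (h : ℤ) : ℂ :=
  ∑ γ : Fin n → Fin (p + 2),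
    if ht h γ n = 0 ∧ ∀ k ≤ n, ht h γ k ≤ 0 then wt a (h - q) γ else 0

lemma Gpoly_pos (a : ℕ → ℤ → ℂ) (p : ℕ) (q : ℤ) (n : ℕ) (h : ℤ) (hh : 0 < h) :
    Gpoly a p q n h = 0 := by
  unfold Gpoly
  refine Finset.sum_eq_zero fun γ _ => if_neg ?_
  rintro ⟨_, h2⟩
  have := h2 0 (Nat.zero_le _)
  rw [ht_zero'] at this
  omega

lemma Gpoly_succ (a : ℕ → ℤ → ℂ) (p : ℕ) (q : ℤ) (n : ℕ) (h : ℤ) (hh : h ≤ 0) :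
    Gpoly a p q (n + 1) h = Gpoly a p q n (h + 1) +
      ∑ k ∈ Finset.range (p + 1), a k (h - q - k) * Gpoly a p q n (h - k) := by
  classical
  have key : Gpoly a p q (n + 1) h = ∑ v : Fin (p + 2),
      (if (v : ℕ) = 0 then 1 else a ((v : ℕ) - 1) (h - q + 1 - ((v : ℕ) : ℤ))) *
        Gpoly a p q n (h + 1 - ((v : ℕ) : ℤ)) := by
    unfold Gpoly
    rw [← (Fin.consEquiv (fun _ : Fin (n + 1) => Fin (p + 2))).sum_comp, Fintype.sum_prod_type]
    refine Finset.sum_congr rfl fun v _ => ?_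
    rw [Finset.mul_sum]
    refine Finset.sum_congr rfl fun γ _ => ?_
    have hc : (Fin.consEquiv (fun _ : Fin (n + 1) => Fin (p + 2))) (v, γ) =
        (Fin.cons v γ : Fin (n + 1) → Fin (p + 2)) := rfl
    rw [hc]
    rw [ht_cons, wt_cons, mul_ite, mul_zero]
    have e : h - q + 1 - ((v : ℕ) : ℤ) = h + 1 - ((v : ℕ) : ℤ) - q := by ring
    rw [e]
    refine if_congr (and_congr_right fun _ => ⟨fun H k hk => ?_, fun H k hk => ?_⟩) rfl rfl
    · rw [← ht_cons]
      exact H (k + 1) (by omega)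
    · cases k with
      | zero => rw [ht_zero']; exact hh
      | succ k => rw [ht_cons]; exact H k (by omega)
  rw [key, Fin.sum_univ_succ, Finset.sum_range]
  congr 1
  · simp
  · refine Finset.sum_congr rfl fun k _ => ?_
    rw [if_neg (by simp)]
    simp only [Fin.val_succ, Nat.add_sub_cancel]
    congr 2 <;> push_cast <;> ring

lemma Gpoly_zero (a : ℕ → ℤ → ℂ) (p : ℕ) (q : ℤ) (h : ℤ) :
    Gpoly a p q 0 h = if h = 0 then 1 else 0 := by
  classical
  unfold Gpoly
  by_cases h0 : h = 0
  · simp [h0, ht, wt]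
  · simp [h0, ht]

lemma Bpoly_eq (a : ℕ → ℤ → ℂ) (p : ℕ) (q : ℤ) (n j : ℕ) :
    Bpoly a p q n j = Gpoly a p q n (-(j : ℤ)) := by
  unfold Bpoly Gpoly Bhset
  rw [Finset.sum_filter]

/-- Let `ℬ_q` be the linear endomorphism of `ℕ →₀ ℂ` determined on the standard basis by
`ℬ_q e_0 = Σ_{k=0}^{p} a^{(k)}_{-k-q} e_k` and
`ℬ_q e_n = e_{n-1} + Σ_{k=0}^{p} a^{(k)}_{-k-q-n} e_{n+k}` for `n ≥ 1`.
Then `⟨ℬ_q^n e_j, e_0⟩ = B^{(q)}_{[n,j]}` for all `n ≥ 0` and `0 ≤ j ≤ p`. -/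
theorem stmt18 (p : ℕ) (hp : 1 ≤ p) (a : ℕ → ℤ → ℂ) (q : ℕ)
    (B : Module.End ℂ (ℕ →₀ ℂ))
    (hB0 : B (Finsupp.single 0 1) =
      ∑ k ∈ Finset.range (p + 1), Finsupp.single k (a k (-(k : ℤ) - q)))
    (hBn : ∀ m : ℕ, 1 ≤ m →
      B (Finsupp.single m 1) =
        Finsupp.single (m - 1) 1 +
          ∑ k ∈ Finset.range (p + 1), Finsupp.single (m + k) (a k (-(k : ℤ) - q - m)))
    (n j : ℕ) (hj : j ≤ p) :
    ((B ^ n) (Finsupp.single j 1)) 0 = Bpoly a p (q : ℤ) n j := by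
  rw [Bpoly_eq]
  clear hj
  induction n generalizing j with
  | zero =>
    rw [Gpoly_zero]
    simp [Finsupp.single_apply]
  | succ n ih =>
    have hs : ∀ (k : ℕ) (c : ℂ), ((B ^ n) (Finsupp.single k c)) 0 =
        c * Gpoly a p q n (-(k : ℤ)) := by
      intro k c
      rw [← ih k, ← smul_eq_mul, ← Finsupp.smul_apply, ← map_smul, Finsupp.smul_single,
        smul_eq_mul, mul_one]
    rw [pow_succ, Module.End.mul_apply, Gpoly_succ _ _ _ _ _ (by omega)]
    rcases Nat.eq_zero_or_pos j with rfl | hj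
    · rw [hB0, map_sum, Finsupp.finsetSum_apply, Gpoly_pos _ _ _ _ _ (by simp), zero_add]
      refine Finset.sum_congr rfl fun k _ => ?_
      rw [hs]
      congr 2 <;> push_cast <;> ring
    · rw [hBn j hj, map_add, Finsupp.add_apply, map_sum, Finsupp.finsetSum_apply, hs, one_mul]
      congr 1
      · congr 1
        omega
      · refine Finset.sum_congr rfl fun k _ => ?_
        rw [hs]
        congr 2 <;> push_cast <;> ring
end
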